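/- arXiv:2101.00363 — 2 statements merged into one kernel-verified Lean document; each statement's English description precedes it below -/
import Mathlib

section
/- Let G be a finite group, N a normal subgroup of G, and let φ: G → Aut(N) send g to conjugation by g. Suppose h is an element of G with h ∉ N, the order of h is a prime q, and φ(h) is an inner automorphism of N (i.e., there exists a ∈ N such that h n h⁻¹ = a n a⁻¹ for all n ∈ N). Then for every prime p dividing |N| with p ≠ q, there exists an element of G of order p*q. -/
/-- Let `N` be normal in a finite group `G` and let `h ∉ N` have prime order `q`.
If conjugation by `h` on `N` is an inner automorphism of `N` (given by some `a ∈ N`),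
then for every prime `p ∣ |N|` with `p ≠ q` there is an element of `G` of order
`p * q`. -/
theorem stmt_10 {G : Type*} [Group G] [Finite G] (N : Subgroup G)
    (hN : N.Normal) (h : G) (hhN : h ∉ N) (q : ℕ) (hq : q.Prime)
    (hordh : orderOf h = q) (a : G) (haN : a ∈ N)
    (hinner : ∀ n ∈ N, h * n * h⁻¹ = a * n * a⁻¹)
    (p : ℕ) (hp : p.Prime) (hpN : p ∣ Nat.card N) (hpq : p ≠ q) :
    ∃ g : G, orderOf g = p * q := by
  have hcomm : ∀ n ∈ N, Commute n (a⁻¹ * h) := fun n hn => by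
    have hn' : h * n = a * n * a⁻¹ * h := by rw [← hinner n hn]; group
    rw [commute_iff_eq, mul_assoc a⁻¹, hn']
    group
  have hmap : QuotientGroup.mk' N (a⁻¹ * h) = QuotientGroup.mk' N h := by
    have ha : QuotientGroup.mk' N a = 1 := (QuotientGroup.eq_one_iff a).2 haN
    rw [map_mul, map_inv, ha, inv_one, one_mul]
  have hq_order : orderOf (QuotientGroup.mk' N h) = q := by
    refine (hq.eq_one_or_self_of_dvd _ (hordh ▸ orderOf_map_dvd _ h)).resolve_left fun h1 => ?_
    exact hhN ((QuotientGroup.eq_one_iff h).1 (orderOf_eq_one_iff.1 h1))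
  have hdvd : q ∣ orderOf (a⁻¹ * h) := by
    simpa only [hmap, hq_order] using orderOf_map_dvd (QuotientGroup.mk' N) (a⁻¹ * h)
  have : Fact p.Prime := ⟨hp⟩
  obtain ⟨x, hx⟩ := exists_prime_orderOf_dvd_card' p hpN
  have hz := orderOf_pow_orderOf_div (orderOf_pos (a⁻¹ * h)).ne' hdvd
  have hx' : orderOf (x : G) = p := by rw [Subgroup.orderOf_coe, hx]
  refine ⟨x * (a⁻¹ * h) ^ (orderOf (a⁻¹ * h) / q), ?_⟩
  rw [((hcomm x x.2).pow_right _).orderOf_mul_eq_mul_orderOf_of_coprime, hx', hz]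
  rw [hx', hz]
  exact (Nat.coprime_primes hp hq).2 hpq
end

section
/- Let G be a finite strictly pseudo-solvable group, i.e., G is not solvable and every composition factor of G is either cyclic of prime order or isomorphic to the alternating group A5. Then G contains a subgroup K possessing a solvable normal subgroup N such that K/N is isomorphic to A5 × H for some solvable group H of order coprime to 30, and moreover |K| and |G| have the same set of prime divisors. -/
/-- A finite group is *pseudo-solvable* if it has a composition series all of whose
factors are cyclic (of prime order) or isomorphic to the alternating group `A₅`.
The factor of a step of the series is expressed as the image of a surjective
homomorphism whose kernel is the previous term. -/
def IsPseudoSolvable (G : Type*) [Group G] : Prop :=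
  ∃ (n : ℕ) (c : Fin (n + 1) → Subgroup G),
    c 0 = ⊥ ∧ c (Fin.last n) = ⊤ ∧
    ∀ i : Fin n,
      c i.castSucc ≤ c i.succ ∧
      ∃ (S : Type) (_ : Group S) (f : ↥(c i.succ) →* S),
        Function.Surjective f ∧
        f.ker = (c i.castSucc).subgroupOf (c i.succ) ∧
        IsSimpleGroup S ∧
        (IsCyclic S ∨ Nonempty (S ≃* alternatingGroup (Fin 5)))

universe u

open Subgroup

/-- Every simple quotient of a subnormal subgroup is solvable or isomorphic to `A₅`. -/
def SubnormalFactorsSolvableOrA5 (G : Type u) [Group G] : Prop :=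
  ∀ A : Subgroup G, A.IsSubnormal → ∀ (T : Type u) [Group T] [IsSimpleGroup T] (f : A →* T),
    Function.Surjective f → Group.IsSolvable T ∨ Nonempty (T ≃* alternatingGroup (Fin 5))

theorem SubnormalFactorsSolvableOrA5.of_surjective {G G' : Type u} [Group G] [Group G']
    (hG : SubnormalFactorsSolvableOrA5 G) (π : G →* G') (hπ : Function.Surjective π) :
    SubnormalFactorsSolvableOrA5 G' := fun A hA T _ _ f hf =>
  hG (A.comap π) (hA.comap π) T (f.comp (π.subgroupComap A))
    (hf.comp (π.subgroupComap_surjective_of_surjective A hπ))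

theorem MulEquiv.nonempty_of_ker_le {A S T : Type*} [Group A] [Group S] [Group T]
    [IsSimpleGroup S] [Nontrivial T] (g : A →* S) (f : A →* T) (hg : Function.Surjective g)
    (hf : Function.Surjective f) (h : g.ker ≤ f.ker) : Nonempty (S ≃* T) := by
  let k : S →* T := g.liftOfSurjective hg ⟨f, h⟩
  have hk : k.comp g = f := g.liftOfRightInverse_comp _ _ ⟨f, h⟩
  have hks : Function.Surjective k := by
    refine Function.Surjective.of_comp (g := g) ?_
    rw [← MonoidHom.coe_comp, hk]
    exact hf
  refine ⟨MulEquiv.ofBijective k ⟨?_, hks⟩⟩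
  rw [← MonoidHom.ker_eq_bot_iff]
  refine (IsSimpleGroup.eq_bot_or_eq_top_of_normal k.ker inferInstance).resolve_right fun htop => ?_
  obtain ⟨t, ht⟩ := exists_ne (1 : T)
  obtain ⟨s, rfl⟩ := hks t
  exact ht (k.mem_ker.1 (htop ▸ mem_top s))

theorem IsPseudoSolvable.subnormalFactors {G : Type u} [Group G] (h : IsPseudoSolvable G) :
    SubnormalFactorsSolvableOrA5 G := by
  obtain ⟨n, c, h0, hn, hc⟩ := h
  intro A hA T _ _ f hf
  let B : Fin (n + 1) → Subgroup T := fun i => ((c i).subgroupOf A).map f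
  have hB : ∃ i : Fin n, B i.castSucc ≠ ⊤ ∧ B i.succ = ⊤ := by
    by_contra! hcon
    have : ∀ i, B i ≠ ⊤ := Fin.induction (by simp [B, h0]) hcon
    refine this (Fin.last n) ?_
    simp only [B, hn, subgroupOf, comap_top]
    rw [← MonoidHom.range_eq_map, MonoidHom.range_eq_top.2 hf]
  obtain ⟨i, hi, hi'⟩ := hB
  obtain ⟨hle, S, _, g, hg, hker, _, hS⟩ := hc i
  let A' : Subgroup (c i.succ) := A.subgroupOf (c i.succ)
  let f' : A' →* T :=
    f.comp (((c i.succ).subtype.comp A'.subtype).codRestrict A fun x => x.2)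
  have hf' : Function.Surjective f' := fun t => by
    obtain ⟨a, ha, rfl⟩ : t ∈ B i.succ := hi' ▸ mem_top t
    exact ⟨⟨⟨a, ha⟩, a.2⟩, rfl⟩
  let g' : A' →* S := g.comp A'.subtype
  have hmem : ∀ x : c i.succ, g x = 1 ↔ (x : G) ∈ c i.castSucc := fun x => by
    rw [← g.mem_ker, hker, mem_subgroupOf]
  have hBn : (B i.castSucc).Normal := by
    refine ⟨fun b hb t => ?_⟩
    obtain ⟨x, hx, rfl⟩ := hb
    obtain ⟨a, ha, rfl⟩ : t ∈ B i.succ := hi' ▸ mem_top t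
    refine ⟨a * x * a⁻¹, ?_, by simp⟩
    have hx' : g ⟨x, hle hx⟩ = 1 := (hmem _).2 hx
    have := (hmem (⟨a, ha⟩ * ⟨x, hle hx⟩ * ⟨a, ha⟩⁻¹)).1 (by simp [hx'])
    exact this
  have hBbot : B i.castSucc = ⊥ :=
    (IsSimpleGroup.eq_bot_or_eq_top_of_normal _ hBn).resolve_right hi
  have hkk : g'.ker ≤ f'.ker := fun x hx => by
    have hx' : ((x : c i.succ) : G) ∈ c i.castSucc := (hmem x).1 hx
    have : f' x ∈ B i.castSucc := ⟨⟨x.1.1, x.2⟩, hx', rfl⟩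
    rwa [hBbot, mem_bot] at this
  have hsn : (A'.map g).IsSubnormal := (hA.subgroupOf).map hg
  rcases hsn.eq_bot_or_top_of_isSimpleGroup ‹_› with hb | ht
  · obtain ⟨t, ht⟩ := exists_ne (1 : T)
    obtain ⟨x, rfl⟩ := hf' t
    have : g' x ∈ A'.map g := mem_map_of_mem g x.2
    rw [hb, mem_bot] at this
    exact absurd (hkk this) ht
  · have hg' : Function.Surjective g' := fun s => by
      obtain ⟨x, hx, rfl⟩ : s ∈ A'.map g := ht ▸ mem_top s
      exact ⟨⟨x, hx⟩, rfl⟩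
    obtain ⟨e⟩ := MulEquiv.nonempty_of_ker_le g' f' hg' hf' hkk
    rcases hS with hS | ⟨⟨e'⟩⟩
    · left
      have : Group.IsSolvable S :=
        IsSimpleGroup.comm_iff_isSolvable.1 fun a b => hS.commGroup.mul_comm a b
      exact Group.isSolvable_of_surjective (f := e.toMonoidHom) e.surjective
    · exact Or.inr ⟨e.symm.trans e'⟩

/-- Distinct conjugates of `S` centralize each other. -/
def Subgroup.ConjugatesCommute {X : Type*} [Group X] (S : Subgroup X) : Prop :=
  ∀ g : X, g ∈ normalizer (S : Set X) ∨ ∀ s ∈ S, ∀ t ∈ S, Commute s (g * t * g⁻¹)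

theorem exists_simple_subnormal (X : Type*) [Group X] [Finite X] [Nontrivial X] :
    ∃ S : Subgroup X, IsSimpleGroup S ∧ S.IsSubnormal ∧ S.ConjugatesCommute := by
  obtain ⟨E, ⟨hEn, hEne⟩, hEmin⟩ := Set.Finite.exists_minimal
    (s := {E : Subgroup X | E.Normal ∧ E ≠ ⊥}) (Set.toFinite _) ⟨⊤, inferInstance, top_ne_bot⟩
  obtain ⟨S, ⟨hSE, hES, hSne⟩, hSmin⟩ := Set.Finite.exists_minimal
    (s := {S : Subgroup X | S ≤ E ∧ E ≤ normalizer (S : Set X) ∧ S ≠ ⊥}) (Set.toFinite _)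
    ⟨E, le_rfl, le_normalizer, hEne⟩
  have hconj : S.ConjugatesCommute := by
    intro g
    by_cases hI : S ⊓ S.map (MulAut.conj g).toMonoidHom = ⊥
    · right
      intro s hs t ht
      have ht' : g * t * g⁻¹ ∈ E := hEn.conj_mem t (hSE ht) g
      have hs' : g⁻¹ * s * g ∈ E := by simpa using hEn.conj_mem s (hSE hs) g⁻¹
      have h1 : s * (g * t * g⁻¹) * s⁻¹ * (g * t * g⁻¹)⁻¹ ∈ S := by
        have := (mem_normalizer_iff.1 (hES ht') s⁻¹).1 (inv_mem hs)
        simpa [mul_assoc] using mul_mem hs this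
      have h2 : s * (g * t * g⁻¹) * s⁻¹ * (g * t * g⁻¹)⁻¹ ∈ S.map (MulAut.conj g).toMonoidHom := by
        have := mul_mem ((mem_normalizer_iff.1 (hES hs') t).1 ht) (inv_mem ht)
        exact ⟨_, this, by simp [mul_assoc]⟩
      have h3 := mem_inf.2 ⟨h1, h2⟩
      rw [hI, mem_bot] at h3
      exact commutatorElement_eq_one_iff_commute.1 h3
    · left
      have hEg : E ≤ normalizer (S.map (MulAut.conj g).toMonoidHom : Set X) := by
        rw [← map_equiv_normalizer_eq]
        refine fun e he => mem_map.2 ⟨g⁻¹ * e * g, hES ?_, by simp [mul_assoc]⟩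
        simpa using hEn.conj_mem e he g⁻¹
      have hle : S ≤ S.map (MulAut.conj g).toMonoidHom :=
        (hSmin ⟨inf_le_left.trans hSE,
          (le_inf hES hEg).trans inf_normalizer_le_normalizer_inf, hI⟩ inf_le_left).trans inf_le_right
      rw [← inv_mem_iff]
      refine mem_normalizer_fintype fun s hs => ?_
      obtain ⟨t, ht, hts⟩ := hle hs
      rw [← hts]
      simpa [mul_assoc] using ht
  refine ⟨S, ?_, ?_, hconj⟩
  · have : Nontrivial S := (nontrivial_iff_ne_bot S).2 hSne
    refine ⟨fun D hD => or_iff_not_imp_left.2 fun hDne => ?_⟩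
    have hDS : D.map S.subtype ≤ S := map_subtype_le D
    have hE : E ≤ normalClosure (S : Set X) :=
      hEmin ⟨inferInstance, fun h => hSne <| le_bot_iff.1 (h ▸ subset_normalClosure)⟩
        (normalClosure_le_normal hSE)
    have hN : E ≤ normalizer (D.map S.subtype : Set X) := by
      refine hE.trans ((closure_le _).2 fun x hx => ?_)
      obtain ⟨s, hs, hx⟩ := Group.mem_conjugatesOfSet_iff.1 hx
      obtain ⟨g, rfl⟩ := isConj_iff.1 hx
      refine mem_normalizer_fintype fun d hd => ?_
      rcases hconj g with hg | hg
      · obtain ⟨d, hd, rfl⟩ := hd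
        exact ⟨_, hD.conj_mem d hd ⟨g * s * g⁻¹, (mem_normalizer_iff.1 hg s).1 hs⟩, rfl⟩
      · rw [← (hg d (hDS hd) s hs).eq, mul_inv_cancel_right]
        exact hd
    have hSD : S ≤ D.map S.subtype :=
      hSmin ⟨hDS.trans hSE, hN, fun h =>
        hDne ((map_eq_bot_iff_of_injective D S.subtype_injective).1 h)⟩ hDS
    refine eq_top_iff.2 fun s _ => ?_
    obtain ⟨d, hd, hds⟩ := hSD s.2
    rwa [← Subtype.ext hds]
  · exact IsSubnormal.trans hSE
      (Normal.isSubnormal ((normal_subgroupOf_iff_le_normalizer hSE).2 hES)) hEn.isSubnormal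

section ConjugateProduct

variable {A X : Type*} [Group A] [Group X] (α : A →* X) (S : Subgroup X)

/-- The embedding of `S` onto the conjugate indexed by a coset of the stabilizer of `S`. -/
noncomputable def conjugateHom (q : A ⧸ (normalizer (S : Set X)).comap α) : S →* X :=
  (MulAut.conj (α q.out)).toMonoidHom.comp S.subtype

variable {S}

theorem conjugateHom_apply (q : A ⧸ (normalizer (S : Set X)).comap α) (s : S) :
    conjugateHom α S q s = α q.out * s * (α q.out)⁻¹ := rfl

theorem Subgroup.ConjugatesCommute.pairwise_commute (hS : S.ConjugatesCommute) :
    Pairwise fun q r : A ⧸ (normalizer (S : Set X)).comap α =>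
      ∀ s t : S, Commute (conjugateHom α S q s) (conjugateHom α S r t) := by
  intro q r hqr s t
  rcases hS (α (q.out⁻¹ * r.out)) with h | h
  · refine absurd ?_ hqr
    rw [← q.out_eq', ← r.out_eq']
    exact QuotientGroup.eq.2 h
  · have := (Commute.conj_iff (α q.out)).2 (h s s.2 t t.2)
    simpa [conjugateHom_apply, mul_assoc] using this

variable [Fintype (A ⧸ (normalizer (S : Set X)).comap α)]

/-- The product map on the conjugates of `S`. -/
noncomputable def conjugatesProd (hS : S.ConjugatesCommute) :
    (A ⧸ (normalizer (S : Set X)).comap α → S) →* X :=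
  MonoidHom.noncommPiCoprod (conjugateHom α S) (hS.pairwise_commute α)

theorem conjugatesProd_mulSingle [DecidableEq (A ⧸ (normalizer (S : Set X)).comap α)]
    (hS : S.ConjugatesCommute) (q : A ⧸ (normalizer (S : Set X)).comap α) (s : S) :
    conjugatesProd α hS (Pi.mulSingle q s) = conjugateHom α S q s :=
  MonoidHom.noncommPiCoprod_mulSingle (conjugateHom α S) q s

theorem Subgroup.ConjugatesCommute.mem_range (hS : S.ConjugatesCommute) (a : A) (s : S) :
    α a * s * (α a)⁻¹ ∈ (conjugatesProd α hS).range := by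
  rw [conjugatesProd, MonoidHom.noncommPiCoprod_range]
  refine mem_iSup_of_mem (a : A ⧸ (normalizer (S : Set X)).comap α) ?_
  obtain ⟨n, hn⟩ := QuotientGroup.mk_out_eq_mul ((normalizer (S : Set X)).comap α) a
  have hmem : (α n)⁻¹ * s * α n ∈ S := (mem_normalizer_iff''.1 n.2 s).1 s.2
  refine ⟨⟨_, hmem⟩, ?_⟩
  rw [conjugateHom_apply, hn]
  simp [mul_assoc]

/-- The product of all the conjugates of an element of `S`. -/
noncomputable def diagonalHom (hS : S.ConjugatesCommute) : S →* X :=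
  (conjugatesProd α hS).comp (MonoidHom.pi fun _ => MonoidHom.id S)

theorem diagonalHom_ker_le_center (hS : S.ConjugatesCommute) :
    (diagonalHom α hS).ker ≤ center S := by
  classical
  intro s hs
  rw [mem_center_iff]
  intro t
  let q : A ⧸ (normalizer (S : Set X)).comap α := (1 : A)
  let Φ := conjugatesProd α hS
  have h1 : Φ (fun _ => s) = 1 := hs
  have h2 : (fun _ => s) * Pi.mulSingle q t * (fun _ => s⁻¹) = Pi.mulSingle q (s * t * s⁻¹) := by
    ext r
    by_cases hr : r = q
    · subst hr; simp
    · simp [hr]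
  have h3 : conjugateHom α S q (s * t * s⁻¹) = conjugateHom α S q t := by
    have hq : ∀ u, Φ (Pi.mulSingle q u) = conjugateHom α S q u := conjugatesProd_mulSingle α hS q
    have h4 : Φ (fun _ => s⁻¹) = 1 := by
      have : (fun _ => s⁻¹ : (A ⧸ (normalizer (S : Set X)).comap α) → S) = (fun _ => s)⁻¹ := rfl
      rw [this, map_inv, h1, inv_one]
    rw [← hq, ← hq, ← h2, map_mul, map_mul, h1, h4, one_mul, mul_one]
  have hinj : Function.Injective (conjugateHom α S q) :=
    (MulAut.conj (α q.out)).injective.comp S.subtype_injective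
  exact (mul_inv_eq_iff_eq_mul.1 (hinj h3)).symm

theorem commute_diagonalHom (hS : S.ConjugatesCommute)
    (hα : ∀ a, α a ∈ normalizer (S : Set X) → ∀ s ∈ S, Commute (α a) s) (a : A) (s : S) :
    Commute (diagonalHom α hS s) (α a) := by
  classical
  let Q := A ⧸ (normalizer (S : Set X)).comap α
  let Φ := conjugatesProd α hS
  let ρ : (Q → S) →* (Q → S) := MonoidHom.pi fun q => Pi.evalMonoidHom _ (a⁻¹ • q)
  have hρ : ∀ (q : Q) (u : S), ρ (Pi.mulSingle q u) = Pi.mulSingle (a • q) u := by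
    intro q u
    ext r
    change ((Pi.mulSingle q u : Q → S) (a⁻¹ • r) : X) = _
    simp only [Pi.mulSingle_apply, inv_smul_eq_iff]
  have hΦ : (MulAut.conj (α a)).toMonoidHom.comp Φ = Φ.comp ρ := by
    refine MonoidHom.pi_ext fun q u => ?_
    have hq : ∀ (r : Q) u, Φ (Pi.mulSingle r u) = conjugateHom α S r u :=
      conjugatesProd_mulSingle α hS
    simp only [MonoidHom.comp_apply, hρ, hq]
    have hmem : α ((a • q).out⁻¹ * (a * q.out)) ∈ normalizer (S : Set X) := by
      refine mem_comap.1 (QuotientGroup.eq.1 ?_)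
      rw [QuotientGroup.out_eq']
      conv_lhs => rw [← QuotientGroup.out_eq' q]
      rfl
    have := (hα _ hmem u u.2).eq
    simp only [conjugateHom_apply, MulEquiv.coe_toMonoidHom, MulAut.conj_apply]
    simp only [map_mul, map_inv] at this
    rw [mul_assoc, inv_mul_eq_iff_eq_mul] at this
    calc α a * (α q.out * u * (α q.out)⁻¹) * (α a)⁻¹
        = (α a * α q.out * u) * (α a * α q.out)⁻¹ := by simp [mul_assoc]
      _ = _ := by rw [this]; simp [mul_assoc]
  have := DFunLike.congr_fun hΦ (fun _ => s)
  simp only [MonoidHom.comp_apply] at this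
  exact (mul_inv_eq_iff_eq_mul.1 this).symm

end ConjugateProduct

theorem card_normalClosure_dvd {X : Type*} [Group X] [Finite X] {S : Subgroup X}
    (hS : S.ConjugatesCommute) : ∃ k, Nat.card (normalClosure (S : Set X)) ∣ Nat.card S ^ k := by
  classical
  have := Fintype.ofFinite (X ⧸ (normalizer (S : Set X)).comap (MonoidHom.id X))
  let Φ := conjugatesProd (MonoidHom.id X) hS
  have hle : normalClosure (S : Set X) ≤ Φ.range := by
    refine (closure_le _).2 fun x hx => ?_
    obtain ⟨s, hs, hx⟩ := Group.mem_conjugatesOfSet_iff.1 hx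
    obtain ⟨g, rfl⟩ := isConj_iff.1 hx
    exact hS.mem_range (MonoidHom.id X) g ⟨s, hs⟩
  have hcard := (card_dvd_of_le hle).trans (card_range_dvd Φ)
  rw [Nat.card_pi, Finset.prod_const] at hcard
  exact ⟨_, hcard⟩

theorem Equiv.Perm.eq_one_of_pow_eq_one_of_card_le {P : Type*} [Finite P] {m : ℕ}
    (hm : m.Coprime 30) (hP : Nat.card P ≤ 6) {σ : Equiv.Perm P} (hσ : σ ^ m = 1) : σ = 1 := by
  rw [← orderOf_eq_one_iff]
  have h1 : orderOf σ ∣ Nat.factorial 6 := by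
    refine (_root_.orderOf_dvd_natCard σ).trans ?_
    rw [Nat.card_perm]
    exact Nat.factorial_dvd_factorial hP
  have h2 : Nat.factorial 6 ∣ 30 ^ 6 := by decide
  exact (hm.pow_right 6).coprime_dvd_left (orderOf_dvd_of_pow_eq_one hσ) |>.eq_one_of_dvd
    (h1.trans h2)

open Pointwise in
theorem MulAut.eq_one_of_pow_eq_one_of_card_eq_sixty {T : Type*} [Group T] [IsSimpleGroup T]
    (hT : Nat.card T = 60) {m : ℕ} (hm : m.Coprime 30) {a : MulAut T} (ha : a ^ m = 1) :
    a = 1 := by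
  have : Finite T := Nat.finite_of_card_ne_zero (by omega)
  have : Fact (Nat.Prime 5) := ⟨Nat.prime_five⟩
  have hcard : ∀ P : Sylow 5 T, Nat.card P = 5 := fun P => by
    rw [P.card_eq_multiplicity, hT]
    have : (60 : ℕ).factorization 5 = 1 := by
      rw [show 60 = 12 * 5 by rfl, Nat.factorization_mul (by norm_num) (by norm_num)]
      simp [Nat.prime_five.factorization_self, Nat.factorization_eq_zero_of_not_dvd]
    rw [this, pow_one]
  have hsyl : Nat.card (Sylow 5 T) ≤ 6 := by
    obtain ⟨P⟩ : Nonempty (Sylow 5 T) := inferInstance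
    have h1 := P.card_dvd_index
    have h2 : (P : Subgroup T).index = 12 := by
      have := (P : Subgroup T).card_mul_index
      rw [hcard P, hT] at this
      omega
    have h3 := card_sylow_modEq_one 5 T
    rw [h2] at h1
    have h4 := Nat.le_of_dvd (by norm_num) h1
    generalize Nat.card (Sylow 5 T) = n at *
    interval_cases n <;> revert h1 h3 <;> decide
  have hfix : ∀ P : Sylow 5 T, a • P = P := fun P => by
    have h : MulAction.toPermHom (MulAut T) (Sylow 5 T) a = 1 :=
      Equiv.Perm.eq_one_of_pow_eq_one_of_card_le hm hsyl (by rw [← map_pow, ha, map_one])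
    exact DFunLike.congr_fun h P
  have hmem : ∀ (P : Sylow 5 T) (x : T), MulAut.toPerm T a x ∈ P ↔ x ∈ P := fun P x => by
    conv_lhs => rw [← hfix P]
    exact smul_mem_pointwise_smul_iff (a := a) (S := (P : Subgroup T)) (x := x)
  have hpt : ∀ (P : Sylow 5 T), ∀ x ∈ P, a x = x := fun P x hx => by
    have h : (MulAut.toPerm T a).subtypePerm (hmem P) = 1 := by
      refine Equiv.Perm.eq_one_of_pow_eq_one_of_card_le (P := {x // x ∈ P}) hm
        ((hcard P).trans_le (by norm_num)) ?_
      rw [Equiv.Perm.subtypePerm_pow]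
      have hpow : MulAut.toPerm T a ^ m = 1 := by rw [← map_pow, ha, map_one]
      ext y
      exact DFunLike.congr_fun hpow (y : T)
    exact congrArg Subtype.val (DFunLike.congr_fun h ⟨x, hx⟩)
  obtain ⟨P⟩ : Nonempty (Sylow 5 T) := inferInstance
  have htop : normalClosure ((P : Subgroup T) : Set T) = ⊤ := by
    refine (IsSimpleGroup.eq_bot_or_eq_top_of_normal _ inferInstance).resolve_left fun h => ?_
    have hP : (P : Subgroup T) = ⊥ := le_bot_iff.1 (h ▸ subset_normalClosure)
    have h5 : Nat.card (P : Subgroup T) = 5 := hcard P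
    rw [hP, card_bot] at h5
    omega
  have hle : normalClosure ((P : Subgroup T) : Set T) ≤ a.toMonoidHom.eqLocus (MonoidHom.id T) := by
    refine (closure_le _).2 fun x hx => ?_
    obtain ⟨s, hs, hx⟩ := Group.mem_conjugatesOfSet_iff.1 hx
    obtain ⟨g, rfl⟩ := isConj_iff.1 hx
    exact hpt (g • P) _ (smul_mem_pointwise_smul s (MulAut.conj g) (P : Subgroup T) hs)
  ext x
  exact hle (htop ▸ mem_top x)

theorem commute_of_mem_normalizer_of_card_eq_sixty {X : Type*} [Group X] {S : Subgroup X}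
    [IsSimpleGroup S] (hS : Nat.card S = 60) {m : ℕ} (hm : m.Coprime 30) {x : X}
    (hx : x ∈ normalizer (S : Set X)) (hxm : x ^ m = 1) {s : X} (hs : s ∈ S) : Commute x s := by
  have h := MulAut.eq_one_of_pow_eq_one_of_card_eq_sixty hS hm
    (a := S.normalizerMonoidHom ⟨x, hx⟩)
    (by
      rw [← map_pow, show (⟨x, hx⟩ : normalizer (S : Set X)) ^ m = 1 from Subtype.ext hxm, map_one])
  have := congrArg Subtype.val (DFunLike.congr_fun h ⟨s, hs⟩)
  exact mul_inv_eq_iff_eq_mul.1 this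

theorem card_alternatingGroup_five : Nat.card (alternatingGroup (Fin 5)) = 60 := by
  rw [nat_card_alternatingGroup, Nat.card_eq_fintype_card, Fintype.card_fin]
  rfl

theorem Subgroup.ConjugatesCommute.isSolvable_normalClosure {X : Type*} [Group X] [Finite X]
    {S : Subgroup X} [IsSimpleGroup S] [IsMulCommutative S] (hS : S.ConjugatesCommute) :
    Group.IsSolvable (normalClosure (S : Set X)) := by
  have hp : (Nat.card S).Prime := Group.is_simple_iff_prime_card.1 inferInstance
  have : Fact (Nat.card S).Prime := ⟨hp⟩
  obtain ⟨k, hk⟩ := card_normalClosure_dvd hS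
  obtain ⟨j, -, hj⟩ := (Nat.dvd_prime_pow hp).1 hk
  have := (IsPGroup.of_card hj).isNilpotent
  infer_instance

theorem exists_normal_solvable_or_dvd {X : Type u} [Group X] [Finite X] [Nontrivial X]
    (hX : SubnormalFactorsSolvableOrA5 X) : ∃ N : Subgroup X, N.Normal ∧ N ≠ ⊥ ∧
      ((Group.IsSolvable N ∧ (Nat.card N).Coprime 30) ∨ ∃ k, Nat.card N ∣ 30 ^ k) := by
  obtain ⟨S, hS, hsn, hconj⟩ := exists_simple_subnormal X
  obtain ⟨k, hk⟩ := card_normalClosure_dvd hconj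
  refine ⟨normalClosure (S : Set X), inferInstance, fun h => (nontrivial_iff_ne_bot S).1 inferInstance
    (le_bot_iff.1 (h ▸ subset_normalClosure)), ?_⟩
  rcases hX S hsn S (MonoidHom.id S) Function.surjective_id with h | ⟨⟨e⟩⟩
  · have hcomm : IsMulCommutative S := ⟨⟨IsSimpleGroup.comm_iff_isSolvable.2 h⟩⟩
    have hp : (Nat.card S).Prime := Group.is_simple_iff_prime_card.1 hS
    by_cases h30 : Nat.card S ∣ 30
    · exact Or.inr ⟨k, hk.trans (pow_dvd_pow_of_dvd h30 k)⟩
    · left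
      exact ⟨hconj.isSolvable_normalClosure,
        ((hp.coprime_iff_not_dvd.2 h30).pow_left k).coprime_dvd_left hk⟩
  · right
    rw [Nat.card_congr e.toEquiv, card_alternatingGroup_five] at hk
    refine ⟨2 * k, hk.trans ?_⟩
    rw [pow_mul]
    exact pow_dvd_pow_of_dvd (by decide) k

theorem card_comap_quotientMk {X : Type*} [Group X] (N : Subgroup X) [N.Normal]
    (H : Subgroup (X ⧸ N)) :
    Nat.card (H.comap (QuotientGroup.mk' N)) = Nat.card N * Nat.card H := by
  have hle : N ≤ H.comap (QuotientGroup.mk' N) := QuotientGroup.le_comap_mk' N H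
  have hsurj := (QuotientGroup.mk' N).subgroupComap_surjective_of_surjective H
    (QuotientGroup.mk'_surjective N)
  have hker : ((QuotientGroup.mk' N).subgroupComap H).ker =
      N.subgroupOf (H.comap (QuotientGroup.mk' N)) := by
    ext x
    rw [MonoidHom.mem_ker, mem_subgroupOf, Subtype.ext_iff]
    exact QuotientGroup.eq_one_iff (x : X)
  rw [← (((QuotientGroup.mk' N).subgroupComap H).ker).card_mul_index, index_ker,
    MonoidHom.range_eq_top.2 hsurj, card_top, hker,
    Nat.card_congr (subgroupOfEquivOfLe hle).toEquiv]

/-- Existence of Hall subgroups for the set of primes not dividing `30`. -/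
theorem exists_solvable_coprime_thirty (n : ℕ) : ∀ (X : Type u) [Group X] [Finite X],
    Nat.card X = n → SubnormalFactorsSolvableOrA5 X →
    ∃ H : Subgroup X, Group.IsSolvable H ∧ (Nat.card H).Coprime 30 ∧
      ∀ p : ℕ, p.Prime → p ∣ Nat.card X → p ∣ 30 ∨ p ∣ Nat.card H := by
  induction n using Nat.strong_induction_on with
  | _ n ih =>
  intro X _ _ hn hX
  rcases subsingleton_or_nontrivial X with hs | hs
  · refine ⟨⊥, inferInstance, by simp, fun p hp h => ?_⟩
    rw [Nat.card_of_subsingleton (1 : X), Nat.dvd_one] at h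
    exact absurd h hp.ne_one
  obtain ⟨N, hN, hNe, hcase⟩ := exists_normal_solvable_or_dvd hX
  have hcard : Nat.card X = Nat.card (X ⧸ N) * Nat.card N :=
    N.card_eq_card_quotient_mul_card_subgroup
  have hlt : Nat.card (X ⧸ N) < n := by
    have h1 : 1 < Nat.card N := one_lt_card_iff_ne_bot N |>.2 hNe
    have h2 : 0 < Nat.card (X ⧸ N) := Nat.card_pos
    rw [← hn, hcard]
    exact lt_mul_of_one_lt_right h2 h1
  obtain ⟨H, hHs, hH30, hHp⟩ := ih _ hlt (X ⧸ N) rfl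
    (hX.of_surjective (QuotientGroup.mk' N) (QuotientGroup.mk'_surjective N))
  let Y := H.comap (QuotientGroup.mk' N)
  have hY : Nat.card Y = Nat.card N * Nat.card H := card_comap_quotientMk N H
  have hNY : N ≤ Y := QuotientGroup.le_comap_mk' N H
  rcases hcase with ⟨hNs, hN30⟩ | ⟨k, hk⟩
  · refine ⟨Y, ?_, hY ▸ hN30.mul_left hH30, fun p hp h => ?_⟩
    · refine Group.isSolvable_of_ker_le_range (inclusion hNY) ((QuotientGroup.mk' N).subgroupComap H)
        fun x hx => ?_
      exact ⟨⟨x, (QuotientGroup.eq_one_iff (x : X)).1 (congrArg Subtype.val hx)⟩, rfl⟩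
    · rw [hcard, hp.dvd_mul] at h
      rw [hY, hp.dvd_mul]
      rcases h with h | h
      · exact (hHp p hp h).imp_right Or.inr
      · exact Or.inr (Or.inl h)
  · let N' := N.subgroupOf Y
    have hN' : Nat.card N' = Nat.card N := Nat.card_congr (subgroupOfEquivOfLe hNY).toEquiv
    have hidx : N'.index = Nat.card H := by
      have := N'.card_mul_index
      rw [hN', hY] at this
      exact Nat.eq_of_mul_eq_mul_left Nat.card_pos this
    obtain ⟨C, hC⟩ := exists_right_complement'_of_coprime (N := N') (by
      rw [hN', hidx]
      exact ((hH30.pow_right k).symm).coprime_dvd_left hk)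
    have hCcard : Nat.card C = Nat.card H := by
      rw [← hidx]; exact hC.symm.index_eq_card.symm
    let θ : C →* H := ((QuotientGroup.mk' N).subgroupComap H).comp C.subtype
    have hθ : Function.Injective θ := by
      rw [← MonoidHom.ker_eq_bot_iff, eq_bot_iff]
      intro x hx
      have hx' : (x : Y) ∈ N' := (QuotientGroup.eq_one_iff ((x : Y) : X)).1 (congrArg Subtype.val hx)
      exact Subtype.ext (disjoint_def.1 hC.disjoint hx' x.2)
    have hCs : Group.IsSolvable C := Group.isSolvable_of_isSolvable_injective hθ
    have hmap : Nat.card (C.map Y.subtype) = Nat.card H :=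
      (card_map_of_injective Y.subtype_injective).trans hCcard
    refine ⟨C.map Y.subtype, Group.isSolvable_of_surjective
      (Y.subtype.subgroupMap_surjective C), hmap ▸ hH30, fun p hp h => ?_⟩
    rw [hcard, hp.dvd_mul] at h
    rcases h with h | h
    · exact hmap ▸ hHp p hp h
    · exact Or.inl (hp.dvd_of_dvd_pow (h.trans hk))

theorem exists_solvable_radical (G : Type*) [Group G] [Finite G] : ∃ R : Subgroup G,
    ∃ _ : R.Normal, Group.IsSolvable R ∧
      ∀ N : Subgroup (G ⧸ R), N.Normal → Group.IsSolvable N → N = ⊥ := by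
  obtain ⟨R, ⟨hRn, hRs⟩, hmax⟩ := Set.Finite.exists_maximal
    (s := {R : Subgroup G | R.Normal ∧ Group.IsSolvable R}) (Set.toFinite _)
    ⟨⊥, inferInstance, inferInstance⟩
  refine ⟨R, hRn, hRs, fun N hN hNs => ?_⟩
  have hle := QuotientGroup.le_comap_mk' R N
  have hsol : Group.IsSolvable (N.comap (QuotientGroup.mk' R)) :=
    Group.isSolvable_of_ker_le_range (inclusion hle) ((QuotientGroup.mk' R).subgroupComap N)
      fun x hx => ⟨⟨x, (QuotientGroup.eq_one_iff (x : G)).1 (congrArg Subtype.val hx)⟩, rfl⟩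
  have := hmax ⟨inferInstance, hsol⟩ hle
  refine eq_bot_iff.2 fun x hx => ?_
  obtain ⟨g, rfl⟩ := QuotientGroup.mk'_surjective R x
  exact (QuotientGroup.eq_one_iff g).2 (this hx)

/-- If no nontrivial normal subgroup is solvable, then `A₅` embeds in the centralizer of every
subgroup of order prime to `30`. -/
theorem exists_injective_commute {X : Type u} [Group X] [Finite X] [Nontrivial X]
    (hX : SubnormalFactorsSolvableOrA5 X)
    (hrad : ∀ N : Subgroup X, N.Normal → Group.IsSolvable N → N = ⊥)
    (H : Subgroup X) (hH : (Nat.card H).Coprime 30) :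
    ∃ ψ : alternatingGroup (Fin 5) →* X, Function.Injective ψ ∧ ∀ a (h : H), Commute (ψ a) h := by
  classical
  obtain ⟨S, hS, hsn, hconj⟩ := exists_simple_subnormal X
  have hSn : ¬ Group.IsSolvable S := fun hsol => by
    have hcomm : IsMulCommutative S := ⟨⟨IsSimpleGroup.comm_iff_isSolvable.2 hsol⟩⟩
    have := hconj.isSolvable_normalClosure
    have h := hrad (normalClosure (S : Set X)) inferInstance this
    exact (nontrivial_iff_ne_bot S).1 inferInstance (le_bot_iff.1 (h ▸ subset_normalClosure))
  obtain ⟨e⟩ := (hX S hsn S (MonoidHom.id S) Function.surjective_id).resolve_left hSn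
  have hcard : Nat.card S = 60 := (Nat.card_congr e.toEquiv).trans card_alternatingGroup_five
  have := Fintype.ofFinite (H ⧸ (normalizer (S : Set X)).comap H.subtype)
  refine ⟨(diagonalHom H.subtype hconj).comp e.symm.toMonoidHom, ?_, fun a h =>
    commute_diagonalHom H.subtype hconj (fun h hh s hs => ?_) h _⟩
  · have hker : (diagonalHom H.subtype hconj).ker = ⊥ := by
      rw [eq_bot_iff]
      refine (diagonalHom_ker_le_center H.subtype hconj).trans (le_of_eq ?_)
      refine (IsSimpleGroup.eq_bot_or_eq_top_of_normal (center S) inferInstance).resolve_right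
        fun htop => hSn (IsSimpleGroup.comm_iff_isSolvable.1 fun a b => ?_)
      exact (mem_center_iff.1 (htop ▸ mem_top b) a)
    exact ((MonoidHom.ker_eq_bot_iff _).1 hker).comp e.symm.injective
  · exact commute_of_mem_normalizer_of_card_eq_sixty hcard hH hh
      (by rw [← map_pow, pow_card_eq_one', map_one]) hs

/-- A finite strictly pseudo-solvable group `G` contains a subgroup `K` with a
solvable normal subgroup `N` such that `K/N ≅ A₅ × H` for some solvable group `H`
of order coprime to `30`, and `|K|` and `|G|` have the same prime divisors. -/
theorem stmt_11 (G : Type*) [Group G] [Finite G]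
    (hps : IsPseudoSolvable G) (hns : ¬ IsSolvable G) :
    ∃ (K : Subgroup G) (N : Subgroup ↥K) (_ : N.Normal),
      IsSolvable ↥N ∧
      (∃ (H : Type) (_ : Group H) (_ : Finite H),
        IsSolvable H ∧ Nat.Coprime (Nat.card H) 30 ∧
        ∃ (f : ↥K →* alternatingGroup (Fin 5) × H),
          Function.Surjective f ∧ f.ker = N) ∧
      (∀ p : ℕ, p.Prime → (p ∣ Nat.card K ↔ p ∣ Nat.card G)) := by
  obtain ⟨R, _, hRs, hrad⟩ := exists_solvable_radical G
  have hX : SubnormalFactorsSolvableOrA5 (G ⧸ R) :=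
    hps.subnormalFactors.of_surjective (QuotientGroup.mk' R) (QuotientGroup.mk'_surjective R)
  have hne : Nontrivial (G ⧸ R) := by
    rw [QuotientGroup.nontrivial_iff]
    rintro rfl
    exact hns (Group.isSolvable_of_surjective (f := (⊤ : Subgroup G).subtype)
      fun g => ⟨⟨g, trivial⟩, rfl⟩)
  obtain ⟨H, hHs, hH30, hHp⟩ := exists_solvable_coprime_thirty _ (G ⧸ R) rfl hX
  obtain ⟨ψ, hψ, hcomm⟩ := exists_injective_commute hX hrad H hH30
  have hA5 : Nat.card ψ.range = 60 :=
    (Nat.card_congr (MonoidHom.ofInjective hψ).toEquiv).symm.trans card_alternatingGroup_five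
  let Θ : alternatingGroup (Fin 5) × H →* G ⧸ R := ψ.noncommCoprod H.subtype hcomm
  have hΘ : Function.Injective Θ := by
    refine (MonoidHom.noncommCoprod_injective _ _ _).2 ⟨hψ, H.subtype_injective, ?_⟩
    refine disjoint_of_coprime_natCard ?_
    rw [hA5, range_subtype]
    exact ((hH30.pow_right 2).symm).coprime_dvd_left (by decide)
  let e := MonoidHom.ofInjective hΘ
  let σ : alternatingGroup (Fin 5) × H ≃* alternatingGroup (Fin 5) × Shrink.{0} H :=
    (MulEquiv.refl _).prodCongr Shrink.mulEquiv.symm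
  let K := Θ.range.comap (QuotientGroup.mk' R)
  have hK : Nat.card K = Nat.card R * (60 * Nat.card H) := by
    rw [card_comap_quotientMk, ← Nat.card_congr e.toEquiv, Nat.card_prod, card_alternatingGroup_five]
  have hRK : R ≤ K := QuotientGroup.le_comap_mk' R _
  let q : K →* Θ.range := (QuotientGroup.mk' R).subgroupComap Θ.range
  have hq : Function.Surjective q := (QuotientGroup.mk' R).subgroupComap_surjective_of_surjective _
    (QuotientGroup.mk'_surjective R)
  refine ⟨K, R.subgroupOf K, inferInstance, ?_, ⟨Shrink.{0} H, inferInstance, inferInstance, ?_, ?_,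
    (e.symm.trans σ).toMonoidHom.comp q, (e.symm.trans σ).surjective.comp hq, ?_⟩,
    fun p hp => ⟨?_, ?_⟩⟩
  · exact Group.isSolvable_of_isSolvable_injective (subgroupOfEquivOfLe hRK).injective
      (f := (subgroupOfEquivOfLe hRK).toMonoidHom)
  · exact Group.isSolvable_of_isSolvable_injective
      (f := (Shrink.mulEquiv : Shrink.{0} H ≃* H).toMonoidHom) Shrink.mulEquiv.injective
  · rwa [Nat.card_congr (equivShrink.{0} H).symm]
  · ext x
    rw [MonoidHom.mem_ker, mem_subgroupOf, MonoidHom.comp_apply, MulEquiv.coe_toMonoidHom,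
      map_eq_one_iff _ (e.symm.trans σ).injective, Subtype.ext_iff]
    exact QuotientGroup.eq_one_iff (x : G)
  · exact fun h => h.trans (card_subgroup_dvd_card K)
  · intro h
    rw [R.card_eq_card_quotient_mul_card_subgroup, hp.dvd_mul] at h
    rw [hK]
    rcases h with h | h
    · rcases hHp p hp h with h | h
      · exact dvd_mul_of_dvd_right (dvd_mul_of_dvd_left (h.trans (by decide)) _) _
      · exact dvd_mul_of_dvd_right (dvd_mul_of_dvd_right h _) _
    · exact dvd_mul_of_dvd_left h _
end
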